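/- Let Γ be a geometric distance-regular graph with classical parameters (D, b, α, β) such that b ≥ 2 and D ≥ 3, with line set 𝓒 (a set of Delsarte cliques such that every edge lies in a unique member), and let r = [D]. If β > (r − α − 1)αb + α, then for each vertex x and each line ℓ ∈ 𝓒 with d(x, ℓ) = 1, and for all vertices y₁, y₂ on ℓ with d(x, y₁) = d(x, y₂) = 2, the sets of lines [x, y₁] and [x, y₂] are equal. -/

import Mathlib

open SimpleGraph

namespace DRGPaper

variable {V : Type*}

/-- `Γ` is a distance-regular graph with diameter `D` and intersection arrays `cc`, `aa`, `bb`: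
`Γ` is connected of diameter `D` and for any vertices `x, y` at distance `i ≤ D`, `y` has exactly
`cc i` neighbours at distance `i - 1` from `x`, `aa i` neighbours at distance `i` from `x`,
and `bb i` neighbours at distance `i + 1` from `x`. -/
def IsDRG [Fintype V] (G : SimpleGraph V) (D : ℕ) (cc aa bb : ℕ → ℕ) : Prop :=
  G.Connected ∧
  (∀ x y : V, G.dist x y ≤ D) ∧
  (∃ x y : V, G.dist x y = D) ∧
  ∀ i : ℕ, i ≤ D → ∀ x y : V, G.dist x y = i →
    {z : V | G.Adj y z ∧ G.dist x z = i - 1}.ncard = cc i ∧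
    {z : V | G.Adj y z ∧ G.dist x z = i}.ncard = aa i ∧
    {z : V | G.Adj y z ∧ G.dist x z = i + 1}.ncard = bb i

/-- `[j] = (b^j - 1)/(b - 1) = 1 + b + ⋯ + b^(j-1)` as a real number. -/
def gauss (b j : ℕ) : ℝ := ∑ i ∈ Finset.range j, (b : ℝ) ^ i

/-- `Γ` has classical parameters `(D, b, α, β)`: it is distance-regular of diameter `D` with
`bb i = ([D] - [i])(β - α[i])` for `0 ≤ i ≤ D - 1` and `cc i = [i](1 + α[i-1])` for
`1 ≤ i ≤ D`. -/
def HasClassicalParams [Fintype V] (G : SimpleGraph V) (D b : ℕ) (α β : ℝ)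
    (cc aa bb : ℕ → ℕ) : Prop :=
  IsDRG G D cc aa bb ∧
  (∀ i : ℕ, i ≤ D - 1 → (bb i : ℝ) = (gauss b D - gauss b i) * (β - α * gauss b i)) ∧
  (∀ i : ℕ, 1 ≤ i → i ≤ D → (cc i : ℝ) = gauss b i * (1 + α * gauss b (i - 1)))

/-- `d(x, C) = min {d(x, y) : y ∈ C}`. -/
noncomputable def distToSet (G : SimpleGraph V) (x : V) (C : Set V) : ℕ :=
  sInf (G.dist x '' C)

/-- A maximal clique of `G`. -/
def IsMaxClique (G : SimpleGraph V) (s : Set V) : Prop :=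
  G.IsClique s ∧ ∀ t : Set V, G.IsClique t → s ⊆ t → t = s

/-- The lines for the PLS(γ) property: maximal cliques with at least `γ` vertices. -/
def plsLines (G : SimpleGraph V) (γ : ℕ) : Set (Set V) :=
  {ℓ : Set V | IsMaxClique G ℓ ∧ γ ≤ ℓ.ncard}

/-- `G` is the point graph of the partial linear space with line set `L`: any two adjacent
vertices lie on exactly one common line of `L`. -/
def IsPointGraphOf (G : SimpleGraph V) (L : Set (Set V)) : Prop :=
  ∀ x y : V, G.Adj x y → ∃! ℓ : Set V, ℓ ∈ L ∧ x ∈ ℓ ∧ y ∈ ℓ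

/-- A vertex is a Delsarte vertex (w.r.t. the line set `L` and classical parameter `β`) if all
lines through it have exactly `β + 1` vertices. -/
def IsDelsarteVertex (L : Set (Set V)) (β : ℝ) (x : V) : Prop :=
  ∀ ℓ ∈ L, x ∈ ℓ → (ℓ.ncard : ℝ) = β + 1

/-- The lines for the SPLS(c, s) property: maximal cliques with at least
`a1 + 2 - (c - 1)(s - 1)` vertices. -/
def splsLines (G : SimpleGraph V) (a1 c s : ℕ) : Set (Set V) :=
  {ℓ : Set V | IsMaxClique G ℓ ∧ (a1 : ℤ) + 2 - ((c : ℤ) - 1) * ((s : ℤ) - 1) ≤ (ℓ.ncard : ℤ)}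

/-- The SPLS(c, s) property: `G` is the point graph of the partial linear space whose lines are
the maximal cliques with at least `a1 + 2 - (c-1)(s-1)` vertices, `a1 ≥ (2s-1)(c-1)`, each
vertex lies on at most `s` lines, and every point not on a line `ℓ` is collinear with at most
`c` points of `ℓ`.  SPLS(s) is the case `c = c₂`. -/
def HasSPLS (G : SimpleGraph V) (a1 c s : ℕ) : Prop :=
  1 ≤ c ∧ 2 ≤ s ∧
  (2 * (s : ℤ) - 1) * ((c : ℤ) - 1) ≤ (a1 : ℤ) ∧
  IsPointGraphOf G (splsLines G a1 c s) ∧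
  (∀ x : V, {ℓ ∈ splsLines G a1 c s | x ∈ ℓ}.ncard ≤ s) ∧
  (∀ ℓ ∈ splsLines G a1 c s, ∀ x : V, x ∉ ℓ → {y ∈ ℓ | G.Adj x y}.ncard ≤ c)

/-- `[x, y]`: the set of lines `ℓ ∈ L` through `x` such that `d(y, u) ≤ 2` for all `u ∈ ℓ`. -/
def lineXY (G : SimpleGraph V) (L : Set (Set V)) (x y : V) : Set (Set V) :=
  {ℓ ∈ L | x ∈ ℓ ∧ ∀ u ∈ ℓ, G.dist y u ≤ 2}

/-- `𝓒` witnesses that `G` is geometric with cliques of order `q`: every member of `𝓒` is a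
clique with exactly `q` vertices and every edge of `G` lies in a unique member of `𝓒`. -/
def IsGeomLineSet (G : SimpleGraph V) (q : ℝ) (𝓒 : Set (Set V)) : Prop :=
  (∀ C ∈ 𝓒, G.IsClique C ∧ (C.ncard : ℝ) = q) ∧
  ∀ x y : V, G.Adj x y → ∃! C : Set V, C ∈ 𝓒 ∧ x ∈ C ∧ y ∈ C

/-- `G` is geometric: there is a set of Delsarte cliques (cliques of the maximum order `q`)
such that every edge lies in a unique member. -/
def IsGeometric (G : SimpleGraph V) (q : ℝ) : Prop :=
  ∃ 𝓒 : Set (Set V), IsGeomLineSet G q 𝓒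

/-- An assembly: a maximal clique which is not a line. -/
def IsAssembly (G : SimpleGraph V) (𝓒 : Set (Set V)) (M : Set V) : Prop :=
  IsMaxClique G M ∧ M ∉ 𝓒

/-- The dual Pasch axiom: for every pair of adjacent vertices `x, y`, the common neighbours of
`x` and `y` outside the (any) line of `𝓒` through `x` and `y` form a clique. -/
def DualPasch (G : SimpleGraph V) (𝓒 : Set (Set V)) : Prop :=
  ∀ x y : V, G.Adj x y → ∀ ℓ ∈ 𝓒, x ∈ ℓ → y ∈ ℓ →
    G.IsClique {z : V | G.Adj x z ∧ G.Adj y z ∧ z ∉ ℓ}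

/-- The `m × n` grid, i.e. the Cartesian product `K_m □ K_n`. -/
def gridGraph (m n : ℕ) : SimpleGraph (Fin m × Fin n) :=
  (⊤ : SimpleGraph (Fin m)).boxProd (⊤ : SimpleGraph (Fin n))

/-- The `A`-clique extension of a graph `H`: replace every vertex of `H` by a clique of size
`A`, vertices in distinct cliques being adjacent exactly when the underlying vertices of `H`
are adjacent. -/
def cliqueExt {W : Type*} (H : SimpleGraph W) (A : ℕ) : SimpleGraph (W × Fin A) :=
  SimpleGraph.fromRel (fun p q => H.Adj p.1 q.1 ∨ p.1 = q.1)

/-- `θ` is an eigenvalue of the adjacency matrix of `G`. -/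
def IsAdjEigenvalue [Fintype V] (G : SimpleGraph V) [DecidableRel G.Adj] (θ : ℝ) : Prop :=
  ∃ v : V → ℝ, v ≠ 0 ∧ (G.adjMatrix ℝ).mulVec v = θ • v

section Counting

/-- The cardinality of a set in a finite type as a real-valued sum of indicators. -/
theorem ncard_setOf_eq_sum {W : Type*} [Fintype W] (P : W → Prop) [DecidablePred P] :
    (({z : W | P z}.ncard : ℕ) : ℝ) = ∑ z, if P z then (1 : ℝ) else 0 := by
  rw [Set.ncard_eq_toFinset_card', Finset.sum_boole]
  simp

/-- A vertex at positive distance `i + 1` from `x` has a neighbour at distance `i` from `x`. -/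
theorem exists_adj_dist_eq {G : SimpleGraph V} (hG : G.Connected) {x y : V} {i : ℕ}
    (hy : G.dist x y = i + 1) : ∃ z, G.Adj y z ∧ G.dist x z = i := by
  obtain ⟨p, hp⟩ := hG.exists_walk_length_eq_dist y x
  cases p with
  | nil => simp at hy
  | cons hadj q =>
    rename_i w
    have h1 := SimpleGraph.dist_le q
    have h2 := hadj.symm.diff_dist_adj (u := x)
    rw [SimpleGraph.Walk.length_cons, G.dist_comm, hy] at hp
    rw [G.dist_comm] at h1
    exact ⟨w, hadj, by omega⟩

/-- In a connected graph, all distances below a realized distance are realized. -/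
theorem exists_dist_eq_of_le {G : SimpleGraph V} (hG : G.Connected) (x : V) {n : ℕ} :
    ∀ {y : V}, G.dist x y = n → ∀ i ≤ n, ∃ z, G.dist x z = i := by
  induction n with
  | zero => intro y hy i hi; exact ⟨y, by omega⟩
  | succ n ih =>
    intro y hy i hi
    rcases Nat.lt_or_ge n i with h | h
    · exact ⟨y, by omega⟩
    obtain ⟨w, -, hw⟩ := exists_adj_dist_eq hG hy
    exact ih hw i h

/-- If the neighbours of `x` in `N` are covered by a set `S` of lines through `x`, each containing
exactly `c` of them, then `|N| = |S| c`. -/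
theorem ncard_eq_ncard_lines_mul [Fintype V] {G : SimpleGraph V} {q c : ℝ} {𝓒 : Set (Set V)}
    (hgeo : IsGeomLineSet G q 𝓒) (x : V) (S : Set (Set V)) (hS : S ⊆ 𝓒)
    (hx : ∀ m ∈ S, x ∈ m) (N : Set V) (hN : ∀ z ∈ N, G.Adj x z)
    (hcov : ∀ z ∈ N, ∃ m ∈ S, z ∈ m)
    (hc : ∀ m ∈ S, (({z | z ∈ m ∧ z ∈ N}.ncard : ℕ) : ℝ) = c) :
    (N.ncard : ℝ) = S.ncard * c := by
  classical
  have h1 : (N.ncard : ℝ) = ∑ z, ∑ m ∈ S.toFinset, if z ∈ m ∧ z ∈ N then (1 : ℝ) else 0 := by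
    rw [show N = {z | z ∈ N} from rfl, ncard_setOf_eq_sum]
    refine Finset.sum_congr rfl fun z _ => ?_
    by_cases hz : z ∈ N
    · obtain ⟨m, hm, hzm⟩ := hcov z hz
      rw [Finset.sum_eq_single m]
      · simp [hz, hzm]
      · intro m' hm' hne
        rw [if_neg]
        rintro ⟨hzm', -⟩
        have hm'S := Set.mem_toFinset.1 hm'
        exact hne ((hgeo.2 x z (hN z hz)).unique ⟨hS hm'S, hx m' hm'S, hzm'⟩
          ⟨hS hm, hx m hm, hzm⟩)
      · intro h
        exact absurd (Set.mem_toFinset.2 hm) h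
    · simp [hz]
  rw [h1, Finset.sum_comm, Finset.sum_congr rfl fun m hm => ?_, Finset.sum_const,
    nsmul_eq_mul, Set.ncard_eq_toFinset_card']
  rw [← ncard_setOf_eq_sum]
  exact hc m (Set.mem_toFinset.1 hm)

end Counting

section Parameters

variable [Fintype V] {G : SimpleGraph V} {D b : ℕ} {α β : ℝ} {cc aa bb : ℕ → ℕ}

theorem gauss_nonneg (b j : ℕ) : 0 ≤ gauss b j :=
  Finset.sum_nonneg fun _ _ => by positivity

theorem gauss_lt_gauss (hb : 0 < b) {i j : ℕ} (hij : i < j) : gauss b i < gauss b j := by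
  have hb' : (0 : ℝ) < b := by exact_mod_cast hb
  exact Finset.sum_lt_sum_of_subset (Finset.range_subset_range.2 hij.le)
    (Finset.mem_range.2 hij) (by simp) (by positivity) fun _ _ _ => by positivity

theorem IsDRG.exists_dist_eq (h : IsDRG G D cc aa bb) {i : ℕ} (hi : i ≤ D) :
    ∃ x y, G.dist x y = i := by
  obtain ⟨x, y, hxy⟩ := h.2.2.1
  obtain ⟨z, hz⟩ := exists_dist_eq_of_le h.1 x hxy i hi
  exact ⟨x, z, hz⟩

theorem IsDRG.cc_pos (h : IsDRG G D cc aa bb) {i : ℕ} (hi : i + 1 ≤ D) : 0 < cc (i + 1) := by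
  obtain ⟨x, y, hxy⟩ := h.exists_dist_eq hi
  obtain ⟨z, hz⟩ := exists_adj_dist_eq h.1 hxy
  rw [← (h.2.2.2 _ hi x y hxy).1, Set.ncard_pos]
  exact ⟨z, hz⟩

theorem IsDRG.bb_pos (h : IsDRG G D cc aa bb) {i : ℕ} (hi : i + 1 ≤ D) : 0 < bb i := by
  obtain ⟨x, y, hxy⟩ := h.exists_dist_eq hi
  obtain ⟨z, hyz, hz⟩ := exists_adj_dist_eq h.1 hxy
  rw [← (h.2.2.2 i (by omega) x z hz).2.2, Set.ncard_pos]
  exact ⟨y, hyz.symm, hxy⟩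

theorem IsDRG.bb_diam (h : IsDRG G D cc aa bb) : bb D = 0 := by
  obtain ⟨x, y, hxy⟩ := h.2.2.1
  rw [← (h.2.2.2 D le_rfl x y hxy).2.2, Set.ncard_eq_zero]
  ext z
  have := h.2.1 x z
  simp only [Set.mem_ofPred_eq, Set.mem_empty_iff_false, iff_false, not_and]
  omega

theorem IsDRG.ncard_adj (h : IsDRG G D cc aa bb) (y : V) : {z | G.Adj y z}.ncard = bb 0 := by
  rw [← (h.2.2.2 0 (Nat.zero_le _) y y (by simp)).2.2]
  congr 1
  ext z
  simp [SimpleGraph.dist_eq_one_iff_adj]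

open Classical in
/-- Summing a function of the distance from `p` over the neighbours of a vertex. -/
theorem IsDRG.sum_adj (h : IsDRG G D cc aa bb) (u : ℕ → ℝ) {p y : V} {i : ℕ}
    (hi : G.dist p y = i + 1) :
    (∑ z, if G.Adj y z then u (G.dist p z) else 0) =
      cc (i + 1) * u i + aa (i + 1) * u (i + 1) + bb (i + 1) * u (i + 2) := by
  have hiD : i + 1 ≤ D := hi ▸ h.2.1 p y
  obtain ⟨h1, h2, h3⟩ := h.2.2.2 _ hiD p y hi
  rw [← h1, ← h2, ← h3, ncard_setOf_eq_sum, ncard_setOf_eq_sum, ncard_setOf_eq_sum,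
    Finset.sum_mul, Finset.sum_mul, Finset.sum_mul, ← Finset.sum_add_distrib,
    ← Finset.sum_add_distrib]
  refine Finset.sum_congr rfl fun z _ => ?_
  by_cases hz : G.Adj y z
  · have := hz.diff_dist_adj (u := p)
    rw [hi] at this
    rcases this with h | h | h
    · simp [hz, h]
    · simp [hz, h, show i + 1 + 1 ≠ i by omega]
    · have : G.dist p z = i := by omega
      simp [hz, this, show i ≠ i + 1 + 1 by omega]
  · simp [hz]

theorem IsDRG.cc_add_aa_add_bb (h : IsDRG G D cc aa bb) {i : ℕ} (hi : i + 1 ≤ D) :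
    (cc (i + 1) : ℝ) + aa (i + 1) + bb (i + 1) = bb 0 := by
  classical
  obtain ⟨x, y, hxy⟩ := h.exists_dist_eq hi
  have := h.sum_adj (fun _ => 1) hxy
  rw [← ncard_setOf_eq_sum, h.ncard_adj] at this
  linarith

theorem HasClassicalParams.pos_beta_sub (h : HasClassicalParams G D b α β cc aa bb)
    (hb : 0 < b) {i : ℕ} (hi : i < D) : 0 < β - α * gauss b i := by
  have h1 := h.2.1 i (by omega)
  have h2 : (0 : ℝ) < bb i := by exact_mod_cast h.1.bb_pos hi
  rw [h1] at h2
  exact (pos_iff_pos_of_mul_pos h2).1 (sub_pos.2 (gauss_lt_gauss hb hi))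

theorem HasClassicalParams.pos_one_add (h : HasClassicalParams G D b α β cc aa bb)
    {i : ℕ} (hi : i < D) : 0 < 1 + α * gauss b i := by
  have h1 := h.2.2 (i + 1) (by omega) hi
  have h2 : (0 : ℝ) < cc (i + 1) := by exact_mod_cast h.1.cc_pos hi
  rw [h1, Nat.add_sub_cancel] at h2
  exact pos_of_mul_pos_right h2 (gauss_nonneg _ _)

theorem HasClassicalParams.pos_beta (h : HasClassicalParams G D b α β cc aa bb)
    (hb : 0 < b) (hD : 0 < D) : 0 < β := by
  simpa [gauss] using h.pos_beta_sub hb hD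

theorem HasClassicalParams.bb_zero (h : HasClassicalParams G D b α β cc aa bb) :
    (bb 0 : ℝ) = gauss b D * β := by
  simpa [gauss] using h.2.1 0 (by omega)

/-- The standard sequence of the eigenvalue `-[D]`. -/
noncomputable def stdSeq (b : ℕ) (α β : ℝ) (i : ℕ) : ℝ :=
  ∏ j ∈ Finset.range i, (-(1 + α * gauss b j) / (β - α * gauss b j))

theorem HasClassicalParams.stdSeq_succ (h : HasClassicalParams G D b α β cc aa bb)
    (hb : 0 < b) {i : ℕ} (hi : i < D) :
    (β - α * gauss b i) * stdSeq b α β (i + 1) = -(1 + α * gauss b i) * stdSeq b α β i := by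
  have := h.pos_beta_sub hb hi
  rw [stdSeq, Finset.prod_range_succ, ← stdSeq]
  field_simp

theorem HasClassicalParams.stdSeq_ne_zero (h : HasClassicalParams G D b α β cc aa bb)
    (hb : 0 < b) {i : ℕ} (hi : i ≤ D) : stdSeq b α β i ≠ 0 := by
  refine Finset.prod_ne_zero_iff.2 fun j hj => ?_
  have hj' : j < D := (Finset.mem_range.1 hj).trans_le hi
  exact div_ne_zero (neg_ne_zero.2 (h.pos_one_add hj').ne') (h.pos_beta_sub hb hj').ne'

open Classical in
/-- The function `y ↦ stdSeq (d(p, y))` is an eigenvector for `-[D]`. -/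
theorem HasClassicalParams.sum_adj_stdSeq (h : HasClassicalParams G D b α β cc aa bb)
    (hb : 0 < b) (hD : 0 < D) (p y : V) :
    (∑ z, if G.Adj y z then stdSeq b α β (G.dist p z) else 0) =
      -gauss b D * stdSeq b α β (G.dist p y) := by
  rcases hi : G.dist p y with _ | i
  · obtain rfl : p = y := by simpa using (h.1.1.dist_eq_zero_iff).1 hi
    have h1 : ∀ z, (if G.Adj p z then stdSeq b α β (G.dist p z) else 0) =
        (if G.Adj p z then 1 else 0) * stdSeq b α β 1 := by
      intro z
      split_ifs with hz
      · rw [SimpleGraph.dist_eq_one_iff_adj.2 hz, one_mul]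
      · rw [zero_mul]
    rw [Finset.sum_congr rfl fun z _ => h1 z, ← Finset.sum_mul, ← ncard_setOf_eq_sum,
      h.1.ncard_adj, h.bb_zero]
    have h2 := h.stdSeq_succ hb hD
    simp only [gauss, Finset.range_zero, Finset.sum_empty, mul_zero, sub_zero, add_zero,
      zero_add] at h2
    rw [mul_assoc, h2]
    simp only [gauss]
    ring
  · have hiD : i + 1 ≤ D := hi ▸ h.1.2.1 p y
    rw [h.1.sum_adj _ hi]
    have hsum := h.1.cc_add_aa_add_bb hiD
    have hc := h.2.2 (i + 1) (by omega) hiD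
    rw [Nat.add_sub_cancel] at hc
    have h1 := h.stdSeq_succ hb (i := i) hiD
    have hbb : (bb (i + 1) : ℝ) =
        (gauss b D - gauss b (i + 1)) * (β - α * gauss b (i + 1)) := by
      rcases hiD.lt_or_eq with hlt | heq
      · exact h.2.1 (i + 1) (by omega)
      · rw [heq, h.1.bb_diam]
        simp
    have h2 : (bb (i + 1) : ℝ) * stdSeq b α β (i + 2) =
        -((gauss b D - gauss b (i + 1)) * (1 + α * gauss b (i + 1))) *
          stdSeq b α β (i + 1) := by
      rcases hiD.lt_or_eq with hlt | heq
      · rw [hbb, mul_assoc, h.stdSeq_succ hb hlt]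
        ring
      · rw [hbb, heq]
        simp
    have ha : (aa (i + 1) : ℝ) = gauss b D * β -
        (gauss b D - gauss b (i + 1)) * (β - α * gauss b (i + 1)) -
        gauss b (i + 1) * (1 + α * gauss b i) := by
      rw [← hbb, ← hc, ← h.bb_zero]
      linarith
    rw [h2, hc, ha]
    linear_combination gauss b (i + 1) * h1

end Parameters

section Geometric

variable [Fintype V] {G : SimpleGraph V} {D b : ℕ} {α β : ℝ} {cc aa bb : ℕ → ℕ}
  {𝓒 : Set (Set V)}

/-- Every vertex lies on exactly `[D]` lines. -/
theorem ncard_lines (h : HasClassicalParams G D b α β cc aa bb) (hb : 0 < b) (hD : 0 < D)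
    (hgeo : IsGeomLineSet G (β + 1) 𝓒) (x : V) :
    (({m | m ∈ 𝓒 ∧ x ∈ m}.ncard : ℕ) : ℝ) = gauss b D := by
  have hβ := h.pos_beta hb hD
  have h1 := ncard_eq_ncard_lines_mul (c := β) hgeo x {m | m ∈ 𝓒 ∧ x ∈ m} (fun m hm => hm.1)
    (fun m hm => hm.2) {z | G.Adj x z} (fun z hz => hz)
    (fun z hz => by
      obtain ⟨m, hm, -⟩ := hgeo.2 x z hz
      exact ⟨m, ⟨hm.1, hm.2.1⟩, hm.2.2⟩)
    (fun m hm => by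
      have h2 : {z | z ∈ m ∧ z ∈ {z | G.Adj x z}} = m \ {x} := by
        ext z
        simp only [Set.mem_ofPred_eq, Set.mem_sdiff, Set.mem_singleton_iff]
        refine and_congr_right fun hz => ⟨fun hadj => hadj.ne', fun hne => ?_⟩
        exact (hgeo.1 m hm.1).1 hm.2 hz (Ne.symm hne)
      have h3 := Set.ncard_sdiff_singleton_add_one hm.2 (Set.toFinite m)
      have h4 := (hgeo.1 m hm.1).2
      rw [h2]
      rw [← h3] at h4
      push_cast at h4
      linarith)
  rw [h.1.ncard_adj, h.bb_zero] at h1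
  exact (mul_right_cancel₀ hβ.ne' h1).symm

open Classical in
/-- If every vertex lies on `r` lines, then an eigenvector for `-r` sums to zero on each line. -/
theorem sum_line_eq_zero {q r : ℝ} (hgeo : IsGeomLineSet G q 𝓒)
    (hr : ∀ x, (({m | m ∈ 𝓒 ∧ x ∈ m}.ncard : ℕ) : ℝ) = r) (v : V → ℝ)
    (hv : ∀ y, (∑ z, if G.Adj y z then v z else 0) = -r * v y) {ℓ : Set V} (hℓ : ℓ ∈ 𝓒) :
    (∑ z, if z ∈ ℓ then v z else 0) = 0 := by
  have hcount : ∀ y z, (∑ m : Set V, if (m ∈ 𝓒 ∧ y ∈ m) ∧ z ∈ m then (1 : ℝ) else 0) =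
      (if y = z then r else 0) + if G.Adj y z then 1 else 0 := by
    intro y z
    by_cases hyz : y = z
    · subst hyz
      simp only [and_assoc, and_self, if_true, SimpleGraph.irrefl, if_false, add_zero]
      rw [← ncard_setOf_eq_sum, hr]
    by_cases hadj : G.Adj y z
    · obtain ⟨m, hm, huniq⟩ := hgeo.2 y z hadj
      rw [Finset.sum_eq_single m]
      · simp [hm, hyz, hadj]
      · intro m' _ hne
        rw [if_neg]
        rintro ⟨⟨h1, h2⟩, h3⟩
        exact hne (huniq m' ⟨h1, h2, h3⟩)
      · simp
    · rw [Finset.sum_eq_zero]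
      · simp [hyz, hadj]
      · intro m _
        rw [if_neg]
        rintro ⟨⟨h1, h2⟩, h3⟩
        exact hadj ((hgeo.1 m h1).1 h2 h3 hyz)
  have hsq : (∑ m : Set V, if m ∈ 𝓒 then (∑ z, if z ∈ m then v z else 0) ^ 2 else 0) = 0 := by
    have h1 : ∀ m : Set V, (if m ∈ 𝓒 then (∑ z, if z ∈ m then v z else 0) ^ 2 else 0) =
        ∑ y, ∑ z, (if (m ∈ 𝓒 ∧ y ∈ m) ∧ z ∈ m then (1 : ℝ) else 0) * (v y * v z) := by
      intro m
      by_cases hm : m ∈ 𝓒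
      · rw [if_pos hm, sq, Finset.sum_mul_sum]
        refine Finset.sum_congr rfl fun y _ => Finset.sum_congr rfl fun z _ => ?_
        by_cases hy : y ∈ m <;> by_cases hz : z ∈ m <;> simp [hm, hy, hz]
      · simp [hm]
    rw [Finset.sum_congr rfl fun m _ => h1 m, Finset.sum_comm]
    refine Finset.sum_eq_zero fun y _ => ?_
    rw [Finset.sum_comm]
    have h2 : ∀ z, (∑ m : Set V, (if (m ∈ 𝓒 ∧ y ∈ m) ∧ z ∈ m then (1 : ℝ) else 0) *
        (v y * v z)) = v y * ((if y = z then r * v z else 0) + if G.Adj y z then v z else 0) := by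
      intro z
      rw [← Finset.sum_mul, hcount]
      split_ifs <;> ring
    rw [Finset.sum_congr rfl fun z _ => h2 z, ← Finset.mul_sum, Finset.sum_add_distrib, hv y]
    simp
  have := (Finset.sum_eq_zero_iff_of_nonneg fun m _ => by
    split_ifs
    · positivity
    · rfl).1 hsq ℓ (Finset.mem_univ _)
  rw [if_pos hℓ] at this
  exact pow_eq_zero_iff (two_ne_zero) |>.1 this

/-- A line at distance `i < D` from `p` has exactly `1 + α[i]` vertices at distance `i`
from `p`. -/
theorem ncard_line_dist_eq (h : HasClassicalParams G D b α β cc aa bb) (hb : 0 < b)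
    (hgeo : IsGeomLineSet G (β + 1) 𝓒) {ℓ : Set V} (hℓ : ℓ ∈ 𝓒) (p : V) {i : ℕ} (hi : i < D)
    (hmin : ∀ z ∈ ℓ, i ≤ G.dist p z) (hex : ∃ z ∈ ℓ, G.dist p z = i) :
    (({z | z ∈ ℓ ∧ G.dist p z = i}.ncard : ℕ) : ℝ) = 1 + α * gauss b i := by
  classical
  have hD : 0 < D := by omega
  have hsum := sum_line_eq_zero hgeo (ncard_lines h hb hD hgeo)
    (fun z => stdSeq b α β (G.dist p z)) (h.sum_adj_stdSeq hb hD p) hℓ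
  have hval : ∀ z, (if z ∈ ℓ then stdSeq b α β (G.dist p z) else 0) =
      (if z ∈ ℓ ∧ G.dist p z = i then 1 else 0) * (stdSeq b α β i - stdSeq b α β (i + 1)) +
      (if z ∈ ℓ then 1 else 0) * stdSeq b α β (i + 1) := by
    intro z
    by_cases hz : z ∈ ℓ
    · by_cases hzi : G.dist p z = i
      · simp [hz, hzi]
      · obtain ⟨w, hw, hwi⟩ := hex
        have hne : w ≠ z := by rintro rfl; exact hzi hwi
        have h1 := ((hgeo.1 ℓ hℓ).1 hw hz hne).diff_dist_adj (u := p)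
        have h2 := hmin z hz
        have h3 : G.dist p z = i + 1 := by omega
        simp [hz, h3]
    · simp [hz]
  rw [Finset.sum_congr rfl fun z _ => hval z, Finset.sum_add_distrib, ← Finset.sum_mul,
    ← Finset.sum_mul, ← ncard_setOf_eq_sum, ← ncard_setOf_eq_sum, Set.ofPred_mem_eq,
    (hgeo.1 ℓ hℓ).2] at hsum
  have hs := h.stdSeq_succ hb hi
  have hu := h.stdSeq_ne_zero hb hi.le
  have hβ := h.pos_beta hb hD
  have hβ1 : β + 1 ≠ 0 := by linarith
  refine mul_left_cancel₀ hβ1 (mul_right_cancel₀ hu ?_)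
  linear_combination (β - α * gauss b i) * hsum -
    (β + 1 - ({z | z ∈ ℓ ∧ G.dist p z = i}.ncard : ℝ)) * hs

/-- If `d(x, y) = 2`, the lines of `[x, y]` are the lines through `x` at distance one from `y`. -/
theorem mem_lineXY_iff (h : HasClassicalParams G D b α β cc aa bb) (hb : 0 < b) (hD : 3 ≤ D)
    (hgeo : IsGeomLineSet G (β + 1) 𝓒) {x y : V} (hxy : G.dist x y = 2) {m : Set V} :
    m ∈ lineXY G 𝓒 x y ↔ m ∈ 𝓒 ∧ x ∈ m ∧ ∃ u ∈ m, G.Adj y u := by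
  refine and_congr_right fun hm => and_congr_right fun hx => ⟨fun hall => ?_, ?_⟩
  · by_contra! hno
    have hge : ∀ u ∈ m, 2 ≤ G.dist y u := by
      intro u hu
      by_contra! hlt
      rcases (by omega : G.dist y u = 0 ∨ G.dist y u = 1) with h0 | h1
      · obtain rfl := (h.1.1.dist_eq_zero_iff).1 h0
        have hne : y ≠ x := by rintro rfl; simp at hxy
        exact hno x hx ((hgeo.1 m hm).1 hu hx hne)
      · exact hno u hu (SimpleGraph.dist_eq_one_iff_adj.1 h1)
    have hcard := ncard_line_dist_eq h hb hgeo hm y (by omega : 2 < D) hge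
      ⟨x, hx, by rw [G.dist_comm, hxy]⟩
    have heq : {z | z ∈ m ∧ G.dist y z = 2} = m := by
      ext z
      exact ⟨fun hz => hz.1, fun hz => ⟨hz, le_antisymm (hall z hz) (hge z hz)⟩⟩
    rw [heq, (hgeo.1 m hm).2] at hcard
    have := h.pos_beta_sub hb (by omega : 2 < D)
    linarith
  · rintro ⟨u, hu, hyu⟩ w hw
    by_cases huw : u = w
    · subst huw
      have := SimpleGraph.dist_eq_one_iff_adj.2 hyu
      omega
    · have h1 := SimpleGraph.dist_eq_one_iff_adj.2 hyu
      have h2 := SimpleGraph.dist_eq_one_iff_adj.2 ((hgeo.1 m hm).1 hu hw huw)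
      have := h.1.1.dist_triangle (u := y) (v := u) (w := w)
      omega

/-- The size of `[x, y]` does not depend on the pair `x, y` at distance two. -/
theorem ncard_lineXY (h : HasClassicalParams G D b α β cc aa bb) (hb : 0 < b) (hD : 3 ≤ D)
    (hgeo : IsGeomLineSet G (β + 1) 𝓒) {x y : V} (hxy : G.dist x y = 2) :
    ((lineXY G 𝓒 x y).ncard : ℝ) = gauss b 2 := by
  have hyx : G.dist y x = 2 := by rw [G.dist_comm, hxy]
  have h1 := ncard_eq_ncard_lines_mul (c := 1 + α * gauss b 1) hgeo x (lineXY G 𝓒 x y)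
    (fun m hm => hm.1) (fun m hm => hm.2.1) {z | G.Adj x z ∧ G.dist y z = 1}
    (fun z hz => hz.1)
    (fun z hz => by
      obtain ⟨m, hm, -⟩ := hgeo.2 x z hz.1
      exact ⟨m, (mem_lineXY_iff h hb hD hgeo hxy).2 ⟨hm.1, hm.2.1, z, hm.2.2,
        SimpleGraph.dist_eq_one_iff_adj.1 hz.2⟩, hm.2.2⟩)
    (fun m hm => by
      have hm' := (mem_lineXY_iff h hb hD hgeo hxy).1 hm
      obtain ⟨u, hu, hyu⟩ := hm'.2.2
      have hge : ∀ z ∈ m, 1 ≤ G.dist y z := by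
        intro z hz
        have hadj := (hgeo.1 m hm.1).1 hm.2.1 hz
        by_contra! hlt
        obtain rfl := (h.1.1.dist_eq_zero_iff).1 (Nat.lt_one_iff.1 hlt)
        have hne : x ≠ y := by rintro rfl; simp at hxy
        have := SimpleGraph.dist_eq_one_iff_adj.2 (hadj hne)
        omega
      rw [← ncard_line_dist_eq h hb hgeo hm.1 y (by omega : 1 < D) hge
        ⟨u, hu, SimpleGraph.dist_eq_one_iff_adj.2 hyu⟩]
      congr 2
      ext z
      simp only [Set.mem_ofPred_eq]
      refine ⟨fun hz => ⟨hz.1, hz.2.2⟩, fun hz => ⟨hz.1, ?_, hz.2⟩⟩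
      refine (hgeo.1 m hm.1).1 hm.2.1 hz.1 ?_
      rintro rfl
      have := hz.2
      omega)
  have h2 := (h.1.2.2.2 2 (by omega) y x hyx).1
  have h3 := h.2.2 2 (by omega) (by omega)
  have h4 := h.pos_one_add (i := 1) (by omega)
  simp only [Nat.add_one_sub_one] at h2 h3
  rw [h2, h3] at h1
  exact (mul_right_cancel₀ h4.ne' h1).symm

/-- A line `m` through `x` that misses `[x, y']` for some `y'` on `ℓ` at distance two from `x`
lies in `[x, y]` for at most `αb` vertices `y` of `ℓ` at distance two from `x`. -/
theorem ncard_le_of_notMem_lineXY (h : HasClassicalParams G D b α β cc aa bb) (hb : 0 < b)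
    (hD : 3 ≤ D) (hgeo : IsGeomLineSet G (β + 1) 𝓒) {x : V} {ℓ : Set V} (hℓ : ℓ ∈ 𝓒)
    (hmin : ∀ z ∈ ℓ, 1 ≤ G.dist x z) (hex : ∃ z ∈ ℓ, G.dist x z = 1) {m : Set V} (hm : m ∈ 𝓒)
    (hxm : x ∈ m) {y' : V} (hy' : y' ∈ ℓ) (hxy' : G.dist x y' = 2)
    (hbad : m ∉ lineXY G 𝓒 x y') :
    (({y | (y ∈ ℓ ∧ G.dist x y = 2) ∧ m ∈ lineXY G 𝓒 x y}.ncard : ℕ) : ℝ) ≤ α * b := by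
  have hno : ∀ u ∈ m, 2 ≤ G.dist u y' := by
    intro u hu
    by_contra! hlt
    rw [mem_lineXY_iff h hb hD hgeo hxy'] at hbad
    rcases (by omega : G.dist u y' = 0 ∨ G.dist u y' = 1) with h0 | h1
    · obtain rfl := (h.1.1.dist_eq_zero_iff).1 h0
      have hne : x ≠ u := by rintro rfl; simp at hxy'
      have := SimpleGraph.dist_eq_one_iff_adj.2 ((hgeo.1 m hm).1 hxm hu hne)
      omega
    · exact hbad ⟨hm, hxm, u, hu, (SimpleGraph.dist_eq_one_iff_adj.1 h1).symm⟩
  have hpos := h.pos_beta_sub hb (by omega : 2 < D)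
  obtain ⟨u, hu, huℓ⟩ : ∃ u ∈ m, ∀ z ∈ ℓ, 2 ≤ G.dist u z := by
    by_contra! hcon
    have hcard := ncard_line_dist_eq h hb hgeo hm y' (by omega : 2 < D)
      (fun z hz => by rw [G.dist_comm]; exact hno z hz) ⟨x, hxm, by rw [G.dist_comm, hxy']⟩
    have heq : {z | z ∈ m ∧ G.dist y' z = 2} = m := by
      ext u
      refine ⟨fun hz => hz.1, fun hu => ⟨hu, ?_⟩⟩
      obtain ⟨z, hz, huz⟩ := hcon u hu
      have h1 := hno u hu
      have hne : z ≠ y' := by rintro rfl; omega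
      have h2 := SimpleGraph.dist_eq_one_iff_adj.2 ((hgeo.1 ℓ hℓ).1 hz hy' hne)
      have := h.1.1.dist_triangle (u := u) (v := z) (w := y')
      rw [G.dist_comm]
      omega
    rw [heq, (hgeo.1 m hm).2] at hcard
    linarith
  obtain ⟨z₀, hz₀, hxz₀⟩ := hex
  have hux : G.dist u x = 1 := by
    rw [SimpleGraph.dist_eq_one_iff_adj]
    refine (hgeo.1 m hm).1 hu hxm ?_
    rintro rfl
    have := huℓ z₀ hz₀
    omega
  have hnear : ∀ z ∈ ℓ, G.dist x z = 1 → G.dist u z = 2 := by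
    intro z hz hxz
    have h1 := huℓ z hz
    have := h.1.1.dist_triangle (u := u) (v := x) (w := z)
    omega
  have hcard2 := ncard_line_dist_eq h hb hgeo hℓ u (by omega : 2 < D) huℓ
    ⟨z₀, hz₀, hnear z₀ hz₀ hxz₀⟩
  have hcard1 := ncard_line_dist_eq h hb hgeo hℓ x (by omega : 1 < D) hmin ⟨z₀, hz₀, hxz₀⟩
  have hdisj : Disjoint {y | (y ∈ ℓ ∧ G.dist x y = 2) ∧ m ∈ lineXY G 𝓒 x y}
      {z | z ∈ ℓ ∧ G.dist x z = 1} := by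
    rw [Set.disjoint_left]
    rintro z ⟨⟨-, h2⟩, -⟩ ⟨-, h1⟩
    omega
  have hsub : {y | (y ∈ ℓ ∧ G.dist x y = 2) ∧ m ∈ lineXY G 𝓒 x y} ∪
      {z | z ∈ ℓ ∧ G.dist x z = 1} ⊆ {z | z ∈ ℓ ∧ G.dist u z = 2} := by
    rintro z (⟨⟨hz, h2⟩, hmz⟩ | ⟨hz, h1⟩)
    · refine ⟨hz, le_antisymm ?_ (huℓ z hz)⟩
      rw [G.dist_comm]
      exact hmz.2.2 u hu
    · exact ⟨hz, hnear z hz h1⟩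
  have hle := Set.ncard_le_ncard hsub (Set.toFinite _)
  rw [Set.ncard_union_eq hdisj] at hle
  have hle' : (({y | (y ∈ ℓ ∧ G.dist x y = 2) ∧ m ∈ lineXY G 𝓒 x y}.ncard : ℕ) : ℝ) +
      (({z | z ∈ ℓ ∧ G.dist x z = 1}.ncard : ℕ) : ℝ) ≤
      (({z | z ∈ ℓ ∧ G.dist u z = 2}.ncard : ℕ) : ℝ) := by exact_mod_cast hle
  rw [hcard1, hcard2] at hle'
  simp only [gauss, Finset.sum_range_succ, Finset.range_zero, Finset.sum_empty, pow_zero,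
    pow_one, zero_add] at hle'
  linarith

/-- At most `[D] - 1 - α` lines through `x` miss `[x, y]` for some `y` on `ℓ` at distance two
from `x`, because the `1 + α` lines through `x` meeting `ℓ` do not. -/
theorem ncard_bad_lines_le (h : HasClassicalParams G D b α β cc aa bb) (hb : 0 < b)
    (hD : 3 ≤ D) (hgeo : IsGeomLineSet G (β + 1) 𝓒) {x : V} {ℓ : Set V} (hℓ : ℓ ∈ 𝓒)
    (hmin : ∀ z ∈ ℓ, 1 ≤ G.dist x z) (hex : ∃ z ∈ ℓ, G.dist x z = 1) :
    (({m | (m ∈ 𝓒 ∧ x ∈ m) ∧ ∃ y ∈ ℓ, G.dist x y = 2 ∧ m ∉ lineXY G 𝓒 x y}.ncard : ℕ) : ℝ)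
      ≤ gauss b D - α - 1 := by
  have hcard1 := ncard_line_dist_eq h hb hgeo hℓ x (by omega : 1 < D) hmin hex
  have hxℓ : x ∉ ℓ := fun hx => by simpa using hmin x hx
  have hlines := ncard_lines h hb (by omega) hgeo x
  have hmeet : ({z | z ∈ ℓ ∧ G.dist x z = 1}.ncard) ≤
      {m | (m ∈ 𝓒 ∧ x ∈ m) ∧ ∃ z ∈ ℓ, z ∈ m}.ncard := by
    choose! f hf using fun z (hz : G.dist x z = 1) =>
      (hgeo.2 x z (SimpleGraph.dist_eq_one_iff_adj.1 hz)).exists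
    refine Set.ncard_le_ncard_of_injOn f ?_ ?_ (Set.toFinite _)
    · rintro z ⟨hz, hxz⟩
      exact ⟨⟨(hf z hxz).1, (hf z hxz).2.1⟩, z, hz, (hf z hxz).2.2⟩
    · rintro z ⟨hz, hxz⟩ w ⟨hw, hxw⟩ hzw
      by_contra hne
      have hadj := (hgeo.1 ℓ hℓ).1 hz hw hne
      have heq := (hgeo.2 z w hadj).unique ⟨hℓ, hz, hw⟩
        ⟨(hf z hxz).1, (hf z hxz).2.2, by rw [hzw]; exact (hf w hxw).2.2⟩
      rw [heq] at hxℓ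
      exact hxℓ (hf z hxz).2.1
  have hdisj : Disjoint
      {m | (m ∈ 𝓒 ∧ x ∈ m) ∧ ∃ y ∈ ℓ, G.dist x y = 2 ∧ m ∉ lineXY G 𝓒 x y}
      {m | (m ∈ 𝓒 ∧ x ∈ m) ∧ ∃ z ∈ ℓ, z ∈ m} := by
    rw [Set.disjoint_left]
    rintro m ⟨⟨hm, hxm⟩, y, hy, hxy, hbad⟩ ⟨-, z, hz, hzm⟩
    refine hbad ((mem_lineXY_iff h hb hD hgeo hxy).2 ⟨hm, hxm, z, hzm, ?_⟩)
    refine (hgeo.1 ℓ hℓ).1 hy hz ?_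
    rintro rfl
    have hne : x ≠ y := by rintro rfl; simp at hxy
    have := SimpleGraph.dist_eq_one_iff_adj.2 ((hgeo.1 m hm).1 hxm hzm hne)
    omega
  have hle := Set.ncard_le_ncard (t := {m | m ∈ 𝓒 ∧ x ∈ m}) (Set.union_subset
    (fun m (hm : m ∈
      {m | (m ∈ 𝓒 ∧ x ∈ m) ∧ ∃ y ∈ ℓ, G.dist x y = 2 ∧ m ∉ lineXY G 𝓒 x y}) => hm.1)
    (fun m (hm : m ∈ {m | (m ∈ 𝓒 ∧ x ∈ m) ∧ ∃ z ∈ ℓ, z ∈ m}) => hm.1)) (Set.toFinite _)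
  rw [Set.ncard_union_eq hdisj] at hle
  have hle' := Nat.cast_le (α := ℝ).2 (le_trans (Nat.add_le_add_left hmeet _) hle)
  push_cast at hle'
  rw [hcard1, hlines] at hle'
  simp only [gauss, Finset.range_one, Finset.sum_singleton, pow_zero, mul_one] at hle' ⊢
  linarith

end Geometric

/-- for a geometric distance-regular graph with classical parameters
`(D, b, α, β)`, `b ≥ 2`, `D ≥ 3`, line set `𝓒` and `r = [D]`: if `β > (r - α - 1)αb + α`,
then for every vertex `x` and line `ℓ ∈ 𝓒` with `d(x, ℓ) = 1` and all `y₁, y₂ ∈ ℓ` at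
distance 2 from `x`, the line sets `[x, y₁]` and `[x, y₂]` are equal. -/
theorem statement_11 {V : Type*} [Fintype V] (G : SimpleGraph V) (D b : ℕ) (α β : ℝ)
    (cc aa bb : ℕ → ℕ) (hb : 2 ≤ b) (hD : 3 ≤ D)
    (h : HasClassicalParams G D b α β cc aa bb)
    (𝓒 : Set (Set V)) (hgeo : IsGeomLineSet G (β + 1) 𝓒)
    (hβ : (gauss b D - α - 1) * α * (b : ℝ) + α < β) :
    ∀ x : V, ∀ ℓ ∈ 𝓒, distToSet G x ℓ = 1 →
      ∀ y₁ ∈ ℓ, ∀ y₂ ∈ ℓ, G.dist x y₁ = 2 → G.dist x y₂ = 2 →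
        lineXY G 𝓒 x y₁ = lineXY G 𝓒 x y₂ := by
  classical
  intro x ℓ hℓ hdist
  have hb0 : 0 < b := by omega
  have hmin : ∀ z ∈ ℓ, 1 ≤ G.dist x z := fun z hz =>
    hdist ▸ Nat.sInf_le (Set.mem_image_of_mem _ hz)
  have hex : ∃ z ∈ ℓ, G.dist x z = 1 := by
    have hne : (G.dist x '' ℓ).Nonempty := by
      by_contra hemp
      rw [Set.not_nonempty_iff_eq_empty] at hemp
      simp [distToSet, hemp] at hdist
    obtain ⟨z, hz, hxz⟩ := Nat.sInf_mem hne
    exact ⟨z, hz, hxz.trans hdist⟩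
  have hcard1 := ncard_line_dist_eq h hb0 hgeo hℓ x (by omega : 1 < D) hmin hex
  simp only [gauss, Finset.range_one, Finset.sum_singleton, pow_zero, mul_one] at hcard1
  have hα : 0 ≤ α := by
    have hpos : 0 < {z | z ∈ ℓ ∧ G.dist x z = 1}.ncard := (Set.ncard_pos).2 hex
    have : (1 : ℝ) ≤ {z | z ∈ ℓ ∧ G.dist x z = 1}.ncard := by exact_mod_cast hpos
    linarith
  set Y : Set V := {y | y ∈ ℓ ∧ G.dist x y = 2} with hY
  have hYcard : (Y.ncard : ℝ) = β - α := by
    have hunion : {z | z ∈ ℓ ∧ G.dist x z = 1} ∪ Y = ℓ := by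
      ext z
      constructor
      · rintro (hz | hz) <;> exact hz.1
      · intro hz
        obtain ⟨w, hw, hxw⟩ := hex
        have h1 := hmin z hz
        by_cases hwz : w = z
        · subst hwz
          exact Or.inl ⟨hz, hxw⟩
        · have h2 := ((hgeo.1 ℓ hℓ).1 hw hz hwz).diff_dist_adj (u := x)
          rcases (by omega : G.dist x z = 1 ∨ G.dist x z = 2) with h3 | h3
          · exact Or.inl ⟨hz, h3⟩
          · exact Or.inr ⟨hz, h3⟩
    have hdisj : Disjoint {z | z ∈ ℓ ∧ G.dist x z = 1} Y := by
      rw [Set.disjoint_left]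
      rintro z ⟨-, h1⟩ ⟨-, h2⟩
      omega
    have h1 := (hgeo.1 ℓ hℓ).2
    rw [← hunion, Set.ncard_union_eq hdisj] at h1
    push_cast at h1
    linarith
  set B : Set (Set V) :=
    {m | (m ∈ 𝓒 ∧ x ∈ m) ∧ ∃ y ∈ ℓ, G.dist x y = 2 ∧ m ∉ lineXY G 𝓒 x y} with hB
  have hBcard : (B.ncard : ℝ) ≤ gauss b D - α - 1 :=
    ncard_bad_lines_le h hb0 hD hgeo hℓ hmin hex
  obtain ⟨y₀, hy₀, hgood⟩ : ∃ y ∈ Y, ∀ m ∈ lineXY G 𝓒 x y, m ∉ B := by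
    by_contra! hcon
    have hsub : Y.toFinset ⊆ B.toFinset.biUnion fun m =>
        {y | (y ∈ ℓ ∧ G.dist x y = 2) ∧ m ∈ lineXY G 𝓒 x y}.toFinset := by
      intro y hy
      have hyY : y ∈ Y := Set.mem_toFinset.1 hy
      obtain ⟨m, hm, hmB⟩ := hcon y hyY
      exact Finset.mem_biUnion.2 ⟨m, Set.mem_toFinset.2 hmB,
        Set.mem_toFinset.2 ⟨hyY, hm⟩⟩
    have hle := Nat.cast_le (α := ℝ).2
      ((Finset.card_le_card hsub).trans Finset.card_biUnion_le)
    rw [← Set.ncard_eq_toFinset_card', hYcard, Nat.cast_sum] at hle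
    have hle2 := hle.trans (Finset.sum_le_card_nsmul _ _ (α * b) fun m hm => by
      obtain ⟨⟨hm1, hm2⟩, y', hy', hxy', hbad⟩ := Set.mem_toFinset.1 hm
      rw [← Set.ncard_eq_toFinset_card']
      exact ncard_le_of_notMem_lineXY h hb0 hD hgeo hℓ hmin hex hm1 hm2 hy' hxy' hbad)
    rw [nsmul_eq_mul, ← Set.ncard_eq_toFinset_card'] at hle2
    have hle3 := mul_le_mul_of_nonneg_right hBcard (by positivity : 0 ≤ α * (b : ℝ))
    linarith
  have key : ∀ y ∈ ℓ, G.dist x y = 2 → lineXY G 𝓒 x y₀ = lineXY G 𝓒 x y := by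
    intro y hy hxy
    refine Set.eq_of_subset_of_ncard_le (fun m hm => ?_) ?_ (Set.toFinite _)
    · by_contra hbad
      exact hgood m hm ⟨⟨hm.1, hm.2.1⟩, y, hy, hxy, hbad⟩
    · have h1 := ncard_lineXY h hb0 hD hgeo hxy
      rw [← ncard_lineXY h hb0 hD hgeo hy₀.2] at h1
      exact (Nat.cast_injective h1).le
  intro y₁ hy₁ y₂ hy₂ hxy₁ hxy₂
  rw [← key y₁ hy₁ hxy₁, key y₂ hy₂ hxy₂]
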